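/- Let X = [0,1]² with the Euclidean (L²) metric d^X, and let P(X) be the set of rectifiable continuous paths γ : [0,1] → X that are nondecreasing with respect to the product (coordinatewise) order on [0,1]². Let dZ^X be the induced zigzag distance. Then the Gromov–Hausdorff distance between the compact metric spaces (X, d^X) and (X, dZ^X) equals 1 − √2/2. -/

import Mathlib

open scoped ENNReal

noncomputable section

/-- The length of a path `γ : ℝ → X`: its total variation on `[0,1]`. -/
def pathLen {X : Type*} [PseudoEMetricSpace X] (γ : ℝ → X) : ℝ≥0∞ :=
  eVariationOn γ (Set.Icc 0 1)

/-- `P` is a d-space structure on `X`: it contains all constant paths, is closed under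
precomposition with continuous nondecreasing maps `[0,1] → [0,1]`, and is closed under
concatenation; all members are continuous on `[0,1]`. -/
structure IsDSpace {X : Type*} [MetricSpace X] (P : Set (ℝ → X)) : Prop where
  cont : ∀ γ ∈ P, ContinuousOn γ (Set.Icc (0:ℝ) 1)
  const_mem : ∀ x : X, (fun _ : ℝ => x) ∈ P
  reparam : ∀ γ ∈ P, ∀ h : ℝ → ℝ, ContinuousOn h (Set.Icc (0:ℝ) 1) →
    MonotoneOn h (Set.Icc (0:ℝ) 1) → Set.MapsTo h (Set.Icc (0:ℝ) 1) (Set.Icc (0:ℝ) 1) →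
    γ ∘ h ∈ P
  concat : ∀ γ ∈ P, ∀ γ' ∈ P, γ 1 = γ' 0 →
    (fun t : ℝ => if t ≤ 1/2 then γ (2*t) else γ' (2*t - 1)) ∈ P

/-- A d-structure is rectifiable if every d-path has finite length. -/
def IsRectifiable {X : Type*} [MetricSpace X] (P : Set (ℝ → X)) : Prop :=
  ∀ γ ∈ P, pathLen γ ≠ ⊤

/-- `γ` is a d-path from `x` to `x'`. -/
def IsDPathFrom {X : Type*} (P : Set (ℝ → X)) (x x' : X) (γ : ℝ → X) : Prop :=
  γ ∈ P ∧ γ 0 = x ∧ γ 1 = x'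

/-- `L` is a zigzag path between `x` and `x'`: a finite sequence of d-paths, each joining
consecutive points `p i`, `p (i+1)` in one direction or the other. -/
def IsZigzagFrom {X : Type*} (P : Set (ℝ → X)) (x x' : X) (L : List (ℝ → X)) : Prop :=
  ∃ p : ℕ → X, p 0 = x ∧ p L.length = x' ∧
    ∀ i : Fin L.length,
      IsDPathFrom P (p i) (p (i + 1)) (L.get i) ∨ IsDPathFrom P (p (i + 1)) (p i) (L.get i)

/-- The length of a zigzag path: the sum of the lengths of its pieces. -/
def zigzagLen {X : Type*} [PseudoEMetricSpace X] (L : List (ℝ → X)) : ℝ≥0∞ :=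
  (L.map pathLen).sum

/-- The zigzag (extended) distance induced by a d-structure `P`. -/
def zzDist {X : Type*} [MetricSpace X] (P : Set (ℝ → X)) (x x' : X) : ℝ≥0∞ :=
  ⨅ L ∈ {L : List (ℝ → X) | IsZigzagFrom P x x' L}, zigzagLen L

/-- Any two points are joined by a zigzag path. -/
def ZigzagConnected {X : Type*} (P : Set (ℝ → X)) : Prop :=
  ∀ x x' : X, ∃ L, IsZigzagFrom P x x' L

/-- A d-map: continuous and sending d-paths to d-paths. -/
def IsDMap {X Y : Type*} [MetricSpace X] [MetricSpace Y]
    (PX : Set (ℝ → X)) (PY : Set (ℝ → Y)) (F : X → Y) : Prop :=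
  Continuous F ∧ ∀ γ ∈ PX, F ∘ γ ∈ PY

/-- The reversed d-structure: `γ ∈ reverseP P` iff `t ↦ γ (1 - t)` belongs to `P`. -/
def reverseP {X : Type*} (P : Set (ℝ → X)) : Set (ℝ → X) :=
  {γ | (fun t => γ (1 - t)) ∈ P}

/-- `|a - b|` for extended nonnegative reals. -/
def ediffAbs (a b : ℝ≥0∞) : ℝ≥0∞ := (a - b) ⊔ (b - a)

/-- Distortion of a map with respect to extended distances on source and target. -/
def edis {X Y : Type*} (dX : X → X → ℝ≥0∞) (dY : Y → Y → ℝ≥0∞) (F : X → Y) : ℝ≥0∞ :=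
  ⨆ x : X, ⨆ x' : X, ediffAbs (dX x x') (dY (F x) (F x'))

/-- Codistortion of a pair of maps with respect to extended distances. -/
def ecodis {X Y : Type*} (dX : X → X → ℝ≥0∞) (dY : Y → Y → ℝ≥0∞)
    (F : X → Y) (G : Y → X) : ℝ≥0∞ :=
  ⨆ x : X, ⨆ y : Y, ediffAbs (dX x (G y)) (dY (F x) y)

/-- The distortion distance between two d-spaces: half the infimum, over pairs of d-maps,
of the maximum of the two distortions and the codistortion (w.r.t. zigzag distances). -/
def ddis {X Y : Type*} [MetricSpace X] [MetricSpace Y]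
    (PX : Set (ℝ → X)) (PY : Set (ℝ → Y)) : ℝ≥0∞ :=
  (1/2 : ℝ≥0∞) * ⨅ (F : {F : X → Y // IsDMap PX PY F}) (G : {G : Y → X // IsDMap PY PX G}),
    max (edis (zzDist PX) (zzDist PY) F.1)
      (max (edis (zzDist PY) (zzDist PX) G.1) (ecodis (zzDist PX) (zzDist PY) F.1 G.1))

/-- A d-correspondence: a relation with surjective projections that matches reachability. -/
def IsDCorrespondence {X Y : Type*} (PX : Set (ℝ → X)) (PY : Set (ℝ → Y))
    (R : Set (X × Y)) : Prop :=
  (∀ x : X, ∃ y : Y, (x, y) ∈ R) ∧ (∀ y : Y, ∃ x : X, (x, y) ∈ R) ∧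
  ∀ p ∈ R, ∀ q ∈ R,
    ((∃ γ, IsDPathFrom PX p.1 q.1 γ) ↔ (∃ γ, IsDPathFrom PY p.2 q.2 γ))

/-- Distortion of a correspondence with respect to the zigzag distances. -/
def corDis {X Y : Type*} [MetricSpace X] [MetricSpace Y]
    (PX : Set (ℝ → X)) (PY : Set (ℝ → Y)) (R : Set (X × Y)) : ℝ≥0∞ :=
  ⨆ p : R, ⨆ q : R, ediffAbs (zzDist PX p.1.1 q.1.1) (zzDist PY p.1.2 q.1.2)

/-- The d-correspondence distortion distance. -/
def dcdis {X Y : Type*} [MetricSpace X] [MetricSpace Y]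
    (PX : Set (ℝ → X)) (PY : Set (ℝ → Y)) : ℝ≥0∞ :=
  (1/2 : ℝ≥0∞) * ⨅ R : {R : Set (X × Y) // IsDCorrespondence PX PY R}, corDis PX PY R.1

/-- Hausdorff distance between two subsets w.r.t. an extended distance. -/
def ehausdorffDist {Z : Type*} (d : Z → Z → ℝ≥0∞) (s t : Set Z) : ℝ≥0∞ :=
  max (⨆ a ∈ s, ⨅ b ∈ t, d a b) (⨆ b ∈ t, ⨅ a ∈ s, d a b)

/-- The unit square `[0,1]²` with the Euclidean (`L²`) metric. -/
abbrev UnitSquare : Type := {p : EuclideanSpace ℝ (Fin 2) // ∀ i, p i ∈ Set.Icc (0:ℝ) 1}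

/-- The d-structure on the unit square: rectifiable continuous paths that are
nondecreasing for the coordinatewise order. -/
def squareP : Set (ℝ → UnitSquare) :=
  {γ | ContinuousOn γ (Set.Icc (0:ℝ) 1) ∧ pathLen γ ≠ ⊤ ∧
    ∀ s ∈ Set.Icc (0:ℝ) 1, ∀ t ∈ Set.Icc (0:ℝ) 1, s ≤ t → ∀ i, (γ s).1 i ≤ (γ t).1 i}

/-- Concatenating a d-path between `x` and `y` to a zigzag path from `y` to `z`. -/
theorem IsZigzagFrom.cons {X : Type*} {P : Set (ℝ → X)} {x y z : X} {γ : ℝ → X}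
    {L : List (ℝ → X)} (h : IsDPathFrom P x y γ ∨ IsDPathFrom P y x γ)
    (hL : IsZigzagFrom P y z L) : IsZigzagFrom P x z (γ :: L) := by
  obtain ⟨p, hp0, hp1, hp⟩ := hL
  refine ⟨fun n => Nat.casesOn n x p, rfl, hp1, ?_⟩
  intro i
  refine Fin.cases ?_ (fun j => ?_) i
  · simpa [hp0] using h
  · simpa using hp j

theorem IsZigzagFrom.nil {X : Type*} (P : Set (ℝ → X)) (x : X) : IsZigzagFrom P x x [] :=
  ⟨fun _ => x, rfl, rfl, fun i => i.elim0⟩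

/-- A map that does not increase the endpoint distance of any d-path relative to its length
does not increase the zigzag distance. -/
theorem edist_le_zzDist {X Y : Type*} [MetricSpace X] [PseudoEMetricSpace Y]
    {P : Set (ℝ → X)} {f : X → Y} (hf : ∀ γ ∈ P, edist (f (γ 0)) (f (γ 1)) ≤ pathLen γ)
    (x y : X) : edist (f x) (f y) ≤ zzDist P x y := by
  refine le_iInf₂ fun L hL => ?_
  obtain ⟨p, rfl, rfl, hp⟩ := hL
  induction L generalizing p with
  | nil => simp
  | cons γ L ih =>
    have h0 := hp ⟨0, by simp⟩
    have hγ : edist (f (p 0)) (f (p 1)) ≤ pathLen γ := by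
      rcases h0 with ⟨h, h0, h1⟩ | ⟨h, h0, h1⟩ <;> simp only [zero_add, List.get_eq_getElem,
        List.getElem_cons_zero] at h h0 h1 <;> rw [← h0, ← h1]
      · exact hf γ h
      · rw [edist_comm]; exact hf γ h
    have hL := ih (fun n => p (n + 1)) (fun i => by simpa using hp i.succ)
    calc edist (f (p 0)) (f (p (L.length + 1)))
        ≤ edist (f (p 0)) (f (p 1)) + edist (f (p 1)) (f (p (L.length + 1))) :=
          edist_triangle _ _ _
      _ ≤ pathLen γ + zigzagLen L := add_le_add hγ hL
      _ = zigzagLen (γ :: L) := by simp [zigzagLen]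

theorem edist_endpoints_le_pathLen {X : Type*} [PseudoEMetricSpace X] (γ : ℝ → X) :
    edist (γ 0) (γ 1) ≤ pathLen γ :=
  eVariationOn.edist_le γ (by simp) (by simp)

theorem UnitSquare.dist_eq (x y : UnitSquare) :
    dist x y = √((x.1 0 - y.1 0) ^ 2 + (x.1 1 - y.1 1) ^ 2) := by
  rw [Subtype.dist_eq, EuclideanSpace.dist_eq, Fin.sum_univ_two, Real.dist_eq, Real.dist_eq,
    sq_abs, sq_abs]

/-- Comparable points of the unit square are joined by a d-path that realizes their distance. -/
theorem exists_squareP_segment {x y : UnitSquare} (h : ∀ i, x.1 i ≤ y.1 i) :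
    ∃ γ, IsDPathFrom squareP x y γ ∧ pathLen γ ≤ edist x y := by
  have hconv : Convex ℝ {p : EuclideanSpace ℝ (Fin 2) | ∀ i, p i ∈ Set.Icc (0:ℝ) 1} := by
    intro p hp q hq a b ha hb hab i
    simpa using convex_Icc (0:ℝ) 1 (hp i) (hq i) ha hb hab
  let γ : ℝ → UnitSquare := fun t => ⟨AffineMap.lineMap x.1 y.1 (Set.projIcc 0 1 zero_le_one t : ℝ),
    hconv.lineMap_mem x.2 y.2 (Set.projIcc 0 1 zero_le_one t).2⟩
  have hlip : LipschitzWith (nndist x y) γ := by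
    refine LipschitzWith.of_dist_le_mul fun s t => ?_
    rw [Subtype.dist_eq, dist_lineMap_lineMap, mul_comm]
    gcongr
    · exact le_of_eq (Subtype.dist_eq _ _).symm
    · simpa [Subtype.dist_eq] using
        (LipschitzWith.projIcc (zero_le_one (α := ℝ))).dist_le_mul s t
  have hlen : pathLen γ ≤ edist x y := by
    have := hlip.lipschitzOnWith (s := Set.univ) |>.comp_eVariationOn_le (g := id)
      (s := Set.Icc (0:ℝ) 1) (Set.mapsTo_univ _ _)
    refine this.trans ?_
    have hid : eVariationOn (id : ℝ → ℝ) (Set.Icc 0 1) ≤ 1 := by simp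
    rw [edist_nndist]
    exact mul_le_of_le_one_right' hid
  refine ⟨γ, ⟨⟨hlip.continuous.continuousOn, ne_top_of_le_ne_top (edist_ne_top _ _) hlen, ?_⟩,
    ?_, ?_⟩, hlen⟩
  · intro s _ t _ hst i
    have hm : (Set.projIcc 0 1 zero_le_one s : ℝ) ≤ Set.projIcc 0 1 zero_le_one t :=
      Set.monotone_projIcc _ hst
    simp only [γ, AffineMap.lineMap_apply, vsub_eq_sub, vadd_eq_add, PiLp.add_apply,
      PiLp.smul_apply, PiLp.sub_apply, smul_eq_mul]
    gcongr
    exact sub_nonneg.2 (h i)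
  · simp [γ]
  · simp [γ]

theorem zzDist_squareP_le_of_le {x y : UnitSquare} (h : ∀ i, x.1 i ≤ y.1 i) :
    zzDist squareP x y ≤ edist x y := by
  obtain ⟨γ, hγ, hlen⟩ := exists_squareP_segment h
  exact (iInf₂_le [γ] ((IsZigzagFrom.nil _ _).cons (.inl hγ))).trans (by simpa [zigzagLen])

theorem zzDist_squareP_le_of_ge {x y : UnitSquare} (h : ∀ i, y.1 i ≤ x.1 i) :
    zzDist squareP x y ≤ edist x y := by
  obtain ⟨γ, hγ, hlen⟩ := exists_squareP_segment h
  rw [edist_comm]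
  exact (iInf₂_le [γ] ((IsZigzagFrom.nil _ _).cons (.inr hγ))).trans (by simpa [zigzagLen])

/-- The corner point with the first coordinate of `x` and the second coordinate of `y`. -/
def UnitSquare.corner (x y : UnitSquare) : UnitSquare :=
  ⟨!₂[x.1 0, y.1 1], by
    intro i
    fin_cases i
    · exact x.2 0
    · exact y.2 1⟩

theorem zzDist_squareP_le_of_ge_of_le {x y : UnitSquare} (h0 : y.1 0 ≤ x.1 0)
    (h1 : x.1 1 ≤ y.1 1) :
    zzDist squareP x y ≤ ENNReal.ofReal ((x.1 0 - y.1 0) + (y.1 1 - x.1 1)) := by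
  obtain ⟨γ, hγ, hγl⟩ := exists_squareP_segment (x := x) (y := UnitSquare.corner x y) (by
    intro i; fin_cases i <;> simp [UnitSquare.corner, h1])
  obtain ⟨δ, hδ, hδl⟩ := exists_squareP_segment (x := y) (y := UnitSquare.corner x y) (by
    intro i; fin_cases i <;> simp [UnitSquare.corner, h0])
  refine (iInf₂_le [γ, δ]
    (((IsZigzagFrom.nil _ _).cons (.inr hδ)).cons (.inl hγ))).trans ?_
  have e0 : dist x (UnitSquare.corner x y) = y.1 1 - x.1 1 := by
    rw [UnitSquare.dist_eq]
    simp [UnitSquare.corner, Real.sqrt_sq_eq_abs, abs_of_nonpos (sub_nonpos.2 h1)]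
  have e1 : dist y (UnitSquare.corner x y) = x.1 0 - y.1 0 := by
    rw [UnitSquare.dist_eq]
    simp [UnitSquare.corner, Real.sqrt_sq_eq_abs, abs_of_nonpos (sub_nonpos.2 h0)]
  rw [add_comm, ENNReal.ofReal_add (sub_nonneg.2 h1) (sub_nonneg.2 h0), ← e0, ← e1,
    ← edist_dist, ← edist_dist]
  simpa [zigzagLen] using add_le_add hγl hδl

theorem zzDist_squareP_le_of_le_of_ge {x y : UnitSquare} (h0 : x.1 0 ≤ y.1 0)
    (h1 : y.1 1 ≤ x.1 1) :
    zzDist squareP x y ≤ ENNReal.ofReal ((y.1 0 - x.1 0) + (x.1 1 - y.1 1)) := by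
  obtain ⟨γ, hγ, hγl⟩ := exists_squareP_segment (x := UnitSquare.corner x y) (y := x) (by
    intro i; fin_cases i <;> simp [UnitSquare.corner, h1])
  obtain ⟨δ, hδ, hδl⟩ := exists_squareP_segment (x := UnitSquare.corner x y) (y := y) (by
    intro i; fin_cases i <;> simp [UnitSquare.corner, h0])
  refine (iInf₂_le [γ, δ]
    (((IsZigzagFrom.nil _ _).cons (.inl hδ)).cons (.inr hγ))).trans ?_
  have e0 : dist (UnitSquare.corner x y) x = x.1 1 - y.1 1 := by
    rw [dist_comm, UnitSquare.dist_eq]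
    simp [UnitSquare.corner, Real.sqrt_sq_eq_abs, abs_of_nonneg (sub_nonneg.2 h1)]
  have e1 : dist (UnitSquare.corner x y) y = y.1 0 - x.1 0 := by
    rw [UnitSquare.dist_eq]
    simp [UnitSquare.corner, Real.sqrt_sq_eq_abs, abs_of_nonpos (sub_nonpos.2 h0)]
  rw [add_comm, ENNReal.ofReal_add (sub_nonneg.2 h1) (sub_nonneg.2 h0), ← e0, ← e1,
    ← edist_dist, ← edist_dist]
  simpa [zigzagLen] using add_le_add hγl hδl

theorem sqrt_two_le_two : √2 ≤ 2 := by
  rw [Real.sqrt_le_left] <;> norm_num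

theorem add_le_sqrt_add {a b : ℝ} (h : a + b ≤ 2) :
    a + b ≤ √(a ^ 2 + b ^ 2) + (2 - √2) := by
  have h2 : √2 ^ 2 = 2 := Real.sq_sqrt zero_le_two
  have hs2 := sqrt_two_le_two
  have key : (a + b) * √2 / 2 ≤ √(a ^ 2 + b ^ 2) := by
    refine Real.le_sqrt_of_sq_le ?_
    nlinarith [sq_nonneg (a - b)]
  nlinarith

theorem zzDist_squareP_le (x y : UnitSquare) :
    zzDist squareP x y ≤ ENNReal.ofReal (dist x y + (2 - √2)) := by
  have hcomp : edist x y ≤ ENNReal.ofReal (dist x y + (2 - √2)) := by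
    rw [edist_dist]
    exact ENNReal.ofReal_le_ofReal (by linarith [sqrt_two_le_two])
  have hx0 := x.2 0
  have hx1 := x.2 1
  have hy0 := y.2 0
  have hy1 := y.2 1
  rcases le_total (x.1 0) (y.1 0) with h0 | h0 <;> rcases le_total (x.1 1) (y.1 1) with h1 | h1
  · exact (zzDist_squareP_le_of_le (Fin.forall_fin_two.2 ⟨h0, h1⟩)).trans hcomp
  · refine (zzDist_squareP_le_of_le_of_ge h0 h1).trans (ENNReal.ofReal_le_ofReal ?_)
    rw [UnitSquare.dist_eq, ← neg_sq (x.1 0 - y.1 0), neg_sub]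
    exact add_le_sqrt_add (by linarith [hx1.2, hy1.1, hy0.2, hx0.1])
  · refine (zzDist_squareP_le_of_ge_of_le h0 h1).trans (ENNReal.ofReal_le_ofReal ?_)
    rw [UnitSquare.dist_eq, ← neg_sq (x.1 1 - y.1 1), neg_sub]
    exact add_le_sqrt_add (by linarith [hy1.2, hx1.1, hx0.2, hy0.1])
  · exact (zzDist_squareP_le_of_ge (Fin.forall_fin_two.2 ⟨h0, h1⟩)).trans hcomp

/-- The zigzag distance on the square dominates the variation of `p ↦ p 0 - p 1`. -/
theorem edist_sub_le_zzDist_squareP (x y : UnitSquare) :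
    edist (x.1 0 - x.1 1) (y.1 0 - y.1 1) ≤ zzDist squareP x y := by
  refine edist_le_zzDist (f := fun p : UnitSquare => p.1 0 - p.1 1) (fun γ hγ => ?_) x y
  refine le_trans ?_ (edist_endpoints_le_pathLen γ)
  have hmono := hγ.2.2 0 (by simp) 1 (by simp) zero_le_one
  have h0 := hmono 0
  have h1 := hmono 1
  rw [edist_dist, edist_dist, UnitSquare.dist_eq, Real.dist_eq]
  refine ENNReal.ofReal_le_ofReal (Real.abs_le_sqrt ?_)
  nlinarith [mul_nonneg (sub_nonneg.2 h0) (sub_nonneg.2 h1)]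

theorem UnitSquare.dist_le_sqrt_two (x y : UnitSquare) : dist x y ≤ √2 := by
  rw [UnitSquare.dist_eq]
  have h (i : Fin 2) : (x.1 i - y.1 i) ^ 2 ≤ 1 := by
    rw [sq_le_one_iff_abs_le_one, abs_le]
    constructor <;> linarith [(x.2 i).1, (x.2 i).2, (y.2 i).1, (y.2 i).2]
  exact Real.sqrt_le_sqrt (by linarith [h 0, h 1])

/-- If all distances in `A` are at most `d`, distances in `B` are at most `d + 2 ghDist A B`. -/
theorem dist_le_add_two_mul_ghDist {A B : Type*} [MetricSpace A] [CompactSpace A] [Nonempty A]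
    [MetricSpace B] [CompactSpace B] [Nonempty B] {d : ℝ} (hA : ∀ a a' : A, dist a a' ≤ d)
    (b b' : B) : dist b b' ≤ d + 2 * GromovHausdorff.ghDist A B := by
  obtain ⟨Φ, Ψ, hΦ, hΨ, h⟩ := GromovHausdorff.ghDist_eq_hausdorffDist A B
  rw [h]
  refine le_of_forall_pos_le_add fun ε hε => ?_
  have hfin : Metric.hausdorffEDist (Set.range Φ) (Set.range Ψ) ≠ ⊤ :=
    Metric.hausdorffEDist_ne_top_of_nonempty_of_bounded (Set.range_nonempty _)
      (Set.range_nonempty _) (isCompact_range hΦ.continuous).isBounded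
      (isCompact_range hΨ.continuous).isBounded
  have near (c : B) : ∃ a, dist (Φ a) (Ψ c) <
      Metric.hausdorffDist (Set.range Φ) (Set.range Ψ) + ε / 2 := by
    obtain ⟨_, ⟨a, rfl⟩, ha⟩ := Metric.exists_dist_lt_of_hausdorffDist_lt' (Set.mem_range_self c)
      (lt_add_of_pos_right _ (half_pos hε)) hfin
    exact ⟨a, ha⟩
  obtain ⟨a, ha⟩ := near b
  obtain ⟨a', ha'⟩ := near b'
  have htri := dist_triangle4 (Ψ b) (Φ a) (Φ a') (Ψ b')
  rw [hΨ.dist_eq, hΦ.dist_eq, dist_comm (Ψ b)] at htri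
  linarith [hA a a']

/-- A bijection of distortion at most `ε` bounds the Gromov–Hausdorff distance by `ε / 2`. -/
theorem ghDist_le_half_of_equiv {A B : Type*} [MetricSpace A] [CompactSpace A] [Nonempty A]
    [MetricSpace B] [CompactSpace B] [Nonempty B] (e : A ≃ B) {ε : ℝ}
    (h : ∀ a a', |dist a a' - dist (e a) (e a')| ≤ ε) :
    GromovHausdorff.ghDist A B ≤ ε / 2 := by
  have := GromovHausdorff.ghDist_le_of_approx_subsets (s := Set.univ) (fun a => e a)
    (ε₁ := 0) (ε₂ := ε) (ε₃ := 0) (fun a => ⟨a, Set.mem_univ a, by simp⟩)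
    (fun b => ⟨⟨e.symm b, Set.mem_univ _⟩, by simp⟩) (fun a a' => h a a')
  simpa using this

/-- The Gromov–Hausdorff distance between the unit square with the
Euclidean metric (represented by `A`) and the unit square with the zigzag metric induced
by the nondecreasing rectifiable paths (represented by `B`) equals `1 - √2/2`. -/
theorem ghDist_square_zigzag
    (A : Type*) [MetricSpace A] [CompactSpace A] [Nonempty A]
    (φ : A ≃ UnitSquare) (hφ : ∀ a a' : A, dist a a' = dist (φ a) (φ a'))
    (B : Type*) [MetricSpace B] [CompactSpace B] [Nonempty B]
    (ψ : B ≃ UnitSquare) (hψ : ∀ b b' : B, edist b b' = zzDist squareP (ψ b) (ψ b')) :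
    GromovHausdorff.ghDist A B = 1 - Real.sqrt 2 / 2 := by
  have hBle (b b' : B) : dist b b' ≤ dist (ψ b) (ψ b') + (2 - √2) := by
    have h := zzDist_squareP_le (ψ b) (ψ b')
    rwa [← hψ, edist_dist, ENNReal.ofReal_le_ofReal_iff
      (add_nonneg dist_nonneg (sub_nonneg.2 sqrt_two_le_two))] at h
  have hleB (b b' : B) : dist (ψ b) (ψ b') ≤ dist b b' := by
    have h := edist_le_zzDist (f := id) (fun γ _ => edist_endpoints_le_pathLen γ)
      (P := squareP) (ψ b) (ψ b')
    rwa [← hψ, edist_dist, edist_dist, ENNReal.ofReal_le_ofReal_iff dist_nonneg] at h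
  apply le_antisymm
  · have := ghDist_le_half_of_equiv (φ.trans ψ.symm) (ε := 2 - √2) fun a a' => by
      have h1 := hBle (ψ.symm (φ a)) (ψ.symm (φ a'))
      have h2 := hleB (ψ.symm (φ a)) (ψ.symm (φ a'))
      simp only [Equiv.apply_symm_apply, ← hφ] at h1 h2
      rw [abs_le, Equiv.trans_apply, Equiv.trans_apply]
      constructor <;> linarith [sqrt_two_le_two]
    linarith
  · let x : UnitSquare := ⟨!₂[1, 0], by intro i; fin_cases i <;> simp⟩
    let y : UnitSquare := ⟨!₂[0, 1], by intro i; fin_cases i <;> simp⟩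
    have h2 : 2 ≤ dist (ψ.symm x) (ψ.symm y) := by
      have h := edist_sub_le_zzDist_squareP x y
      rw [← ψ.apply_symm_apply x, ← ψ.apply_symm_apply y, ← hψ, edist_dist, edist_dist,
        ENNReal.ofReal_le_ofReal_iff dist_nonneg, Equiv.apply_symm_apply,
        Equiv.apply_symm_apply, Real.dist_eq] at h
      norm_num [x, y] at h
      exact h
    have h := dist_le_add_two_mul_ghDist
      (fun a a' : A => (hφ a a').trans_le (UnitSquare.dist_le_sqrt_two _ _))
      (ψ.symm x) (ψ.symm y)
    linarith

end
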